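/- arXiv:1509.04518 — 5 statements merged into one kernel-verified Lean document; each statement's English description precedes it below -/
import Mathlib

section
/- Let Δ > 0 and let g : ℝ → ℝ have a K-Lipschitz derivative on [0, Δ]. Define E = 2(g(0) − g(Δ)) + (g'(0) + g'(Δ))·Δ, d = √(E² + (g'(Δ) − g'(0))²·Δ²), and w = (|E| + d) / Δ². Then w ≤ K; that is, the adaptive estimate w computed from the function values and derivative values at the two endpoints never overestimates the true Lipschitz constant of the derivative. -/
/-- If `g'` is `K`-Lipschitz on `[0, Δ]`, then `g` lies above the piecewise quadratic with second
derivative `-K` that matches `g` to first order at `0` and, run backwards, at `Δ`. -/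
lemma le_sub_of_lipschitz_deriv {Δ K : ℝ} (hΔ : 0 ≤ Δ) {g g' : ℝ → ℝ}
    (hderiv : ∀ x ∈ Set.Icc (0 : ℝ) Δ, HasDerivWithinAt g (g' x) (Set.Icc (0 : ℝ) Δ) x)
    (hlip : ∀ x ∈ Set.Icc (0 : ℝ) Δ, ∀ y ∈ Set.Icc (0 : ℝ) Δ, |g' x - g' y| ≤ K * |x - y|)
    {c : ℝ} (hc : c ∈ Set.Icc (0 : ℝ) Δ) :
    g' 0 * c - K * c ^ 2 / 2 + (g' Δ * (Δ - c) - K * (Δ - c) ^ 2 / 2) ≤ g Δ - g 0 := by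
  have h0 : (0 : ℝ) ∈ Set.Icc 0 Δ := ⟨le_rfl, hΔ⟩
  have h1 : Δ ∈ Set.Icc 0 Δ := ⟨hΔ, le_rfl⟩
  have hleft : MonotoneOn (fun x ↦ g x - g' 0 * x + K * x ^ 2 / 2) (Set.Icc 0 Δ) := by
    have hd : ∀ x ∈ Set.Icc (0 : ℝ) Δ, HasDerivWithinAt
        (fun x ↦ g x - g' 0 * x + K * x ^ 2 / 2) (g' x - g' 0 + K * x) (Set.Icc 0 Δ) x := by
      intro x hx
      have hid := hasDerivWithinAt_id x (Set.Icc (0 : ℝ) Δ)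
      refine (((hderiv x hx).sub (hid.const_mul (g' 0))).add
        (((hid.pow 2).const_mul K).div_const 2)).congr_deriv ?_
      simp only [id]
      norm_num
      ring
    refine monotoneOn_of_hasDerivWithinAt_nonneg (convex_Icc 0 Δ)
      (fun x hx ↦ (hd x hx).continuousWithinAt)
      (fun x hx ↦ (hd x (interior_subset hx)).mono interior_subset) fun x hx ↦ ?_
    have hx' := interior_subset hx
    have h := (abs_le.1 (hlip x hx' 0 h0)).1
    rw [sub_zero, abs_of_nonneg hx'.1] at h
    linarith
  have hright : MonotoneOn (fun x ↦ g x - g' Δ * x - K * (Δ - x) ^ 2 / 2) (Set.Icc 0 Δ) := by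
    have hd : ∀ x ∈ Set.Icc (0 : ℝ) Δ, HasDerivWithinAt
        (fun x ↦ g x - g' Δ * x - K * (Δ - x) ^ 2 / 2) (g' x - g' Δ + K * (Δ - x))
        (Set.Icc 0 Δ) x := by
      intro x hx
      have hid := hasDerivWithinAt_id x (Set.Icc (0 : ℝ) Δ)
      refine (((hderiv x hx).sub (hid.const_mul (g' Δ))).sub
        ((((hid.const_sub Δ).pow 2).const_mul K).div_const 2)).congr_deriv ?_
      simp only [id]
      norm_num
      ring
    refine monotoneOn_of_hasDerivWithinAt_nonneg (convex_Icc 0 Δ)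
      (fun x hx ↦ (hd x hx).continuousWithinAt)
      (fun x hx ↦ (hd x (interior_subset hx)).mono interior_subset) fun x hx ↦ ?_
    have hx' := interior_subset hx
    have h := (abs_le.1 (hlip x hx' Δ h1)).1
    rw [abs_sub_comm x Δ, abs_of_nonneg (sub_nonneg.2 hx'.2)] at h
    linarith
  have hl := hleft h0 hc hc.1
  have hr := hright hc h1 hc.2
  simp only at hl hr
  linarith

/-- One-sided bounds on the endpoint defect of the trapezoidal rule for a function whose
derivative is `K`-Lipschitz. -/
lemma trapezoidal_defect_le_of_lipschitz_deriv {Δ K : ℝ} (hΔ : 0 ≤ Δ) (hK : 0 ≤ K)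
    {g g' : ℝ → ℝ}
    (hderiv : ∀ x ∈ Set.Icc (0 : ℝ) Δ, HasDerivWithinAt g (g' x) (Set.Icc (0 : ℝ) Δ) x)
    (hlip : ∀ x ∈ Set.Icc (0 : ℝ) Δ, ∀ y ∈ Set.Icc (0 : ℝ) Δ, |g' x - g' y| ≤ K * |x - y|) :
    2 * (g 0 - g Δ) + (g' 0 + g' Δ) * Δ ≤ K * Δ ^ 2 / 2 ∧
      2 * K * (2 * (g 0 - g Δ) + (g' 0 + g' Δ) * Δ) ≤ K ^ 2 * Δ ^ 2 - (g' Δ - g' 0) ^ 2 := by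
  have hD := hlip Δ ⟨hΔ, le_rfl⟩ 0 ⟨le_rfl, hΔ⟩
  rw [sub_zero, abs_of_nonneg hΔ, abs_le] at hD
  constructor
  · have h := le_sub_of_lipschitz_deriv hΔ hderiv hlip (c := Δ / 2) ⟨by linarith, by linarith⟩
    linarith
  · rcases hK.eq_or_lt with rfl | hK
    · have : g' Δ - g' 0 = 0 := by linarith [hD.1, hD.2]
      simp [this]
    · obtain ⟨t, ht⟩ : ∃ t, g' Δ - g' 0 = 2 * K * t :=
        ⟨(g' Δ - g' 0) / (2 * K), by field_simp⟩
      have h := le_sub_of_lipschitz_deriv hΔ hderiv hlip (c := Δ / 2 - t)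
        ⟨by nlinarith, by nlinarith⟩
      have hb : g' Δ = g' 0 + 2 * K * t := by linarith
      rw [ht]
      rw [hb] at h ⊢
      nlinarith [mul_le_mul_of_nonneg_left h hK.le]

/-- If `g : ℝ → ℝ` has a `K`-Lipschitz derivative `g'` on `[0, Δ]` (with `Δ > 0`,
`K ≥ 0`), and `E = 2(g 0 - g Δ) + (g' 0 + g' Δ)Δ`, `d = √(E² + (g' Δ - g' 0)²Δ²)`,
`w = (|E| + d)/Δ²`, then `w ≤ K`: the adaptive endpoint-based estimate never overestimates
the true Lipschitz constant of the derivative. -/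
theorem adaptive_estimate_le_lipschitz_constant
    (Δ K : ℝ) (hΔ : 0 < Δ) (hK : 0 ≤ K) (g g' : ℝ → ℝ)
    (hderiv : ∀ x ∈ Set.Icc (0 : ℝ) Δ, HasDerivWithinAt g (g' x) (Set.Icc (0 : ℝ) Δ) x)
    (hlip : ∀ x' ∈ Set.Icc (0 : ℝ) Δ, ∀ x'' ∈ Set.Icc (0 : ℝ) Δ,
      |g' x' - g' x''| ≤ K * |x' - x''|)
    (E d w : ℝ)
    (hE : E = 2 * (g 0 - g Δ) + (g' 0 + g' Δ) * Δ)
    (hd : d = Real.sqrt (E ^ 2 + (g' Δ - g' 0) ^ 2 * Δ ^ 2))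
    (hw : w = (|E| + d) / Δ ^ 2) :
    w ≤ K := by
  obtain ⟨hE1, hE2⟩ := trapezoidal_defect_le_of_lipschitz_deriv hΔ.le hK hderiv hlip
  obtain ⟨hN1, hN2⟩ := trapezoidal_defect_le_of_lipschitz_deriv (g := fun x ↦ -g x)
    (g' := fun x ↦ -g' x) hΔ.le hK (fun x hx ↦ (hderiv x hx).neg) fun x hx y hy ↦ by
      rw [← neg_sub', abs_neg]
      exact hlip x hx y hy
  have habs : |E| ≤ K * Δ ^ 2 / 2 := abs_le.2 ⟨by linarith, by linarith⟩
  have hmul : 2 * K * |E| ≤ K ^ 2 * Δ ^ 2 - (g' Δ - g' 0) ^ 2 := by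
    rcases abs_choice E with h | h <;> rw [h, hE] <;> linarith
  have hd' : d ≤ K * Δ ^ 2 - |E| := by
    rw [hd]
    refine Real.sqrt_le_iff.2 ⟨by nlinarith [sq_nonneg Δ], ?_⟩
    nlinarith [mul_le_mul_of_nonneg_right hmul (sq_nonneg Δ), sq_abs E]
  rw [hw, div_le_iff₀ (by positivity)]
  linarith
end

section
/- Let D = [a, b] ⊂ ℝ^N be a hyperinterval, let f : ℝ^N → ℝ be differentiable on D with gradient f' satisfying ‖f'(x') − f'(x'')‖ ≤ K‖x' − x''‖ for all x', x'' ∈ D (Euclidean norm), and let D_i = [a_i, b_i] ⊆ D be a sub-hyperinterval with a_i ≠ b_i and main diagonal length Δ_i = ‖a_i − b_i‖. Define the directional derivatives along the main diagonal f'(a_i) = (Σ_{j=1}^{N} (∂f/∂x(j))(a_i)·(b_i(j) − a_i(j)))/Δ_i and f'(b_i) = (Σ_{j=1}^{N} (∂f/∂x(j))(b_i)·(b_i(j) − a_i(j)))/Δ_i, and set E_i = 2(f(a_i) − f(b_i)) + (f'(a_i) + f'(b_i))·Δ_i, d_i = √(E_i² + (f'(b_i) − f'(a_i))²·Δ_i²),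 and w_i = (|E_i| + d_i)/Δ_i². Then w_i ≤ K. -/
/-- Descent lemma: a function whose gradient is `K`-Lipschitz on a convex set differs from its
first-order Taylor polynomial by at most `K / 2 * ‖y - x‖ ^ 2`. -/
theorem abs_sub_sub_inner_le_of_gradient_lipschitz {F : Type*} [NormedAddCommGroup F]
    [InnerProductSpace ℝ F] [CompleteSpace F] {f : F → ℝ} {f' : F → F} {D : Set F} {K : ℝ}
    (hD : Convex ℝ D) (hgrad : ∀ x ∈ D, HasGradientWithinAt f (f' x) D x)
    (hlip : ∀ x ∈ D, ∀ y ∈ D, ‖f' x - f' y‖ ≤ K * ‖x - y‖) {x y : F} (hx : x ∈ D) (hy : y ∈ D) :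
    |f y - f x - inner ℝ (f' x) (y - x)| ≤ K / 2 * ‖y - x‖ ^ 2 := by
  have hmem : ∀ t ∈ Set.Icc (0 : ℝ) 1, x + t • (y - x) ∈ D :=
    fun t ht => hD.add_smul_sub_mem hx hy ht
  have hder : ∀ t ∈ Set.Icc (0 : ℝ) 1, HasDerivWithinAt
      (fun t : ℝ => f (x + t • (y - x)) - f x - t * inner ℝ (f' x) (y - x))
      (inner ℝ (f' (x + t • (y - x))) (y - x) - inner ℝ (f' x) (y - x)) (Set.Icc 0 1) t := by
    intro t ht
    have hline : HasDerivWithinAt (fun t : ℝ => x + t • (y - x)) (y - x) (Set.Icc 0 1) t := by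
      simpa using (((hasDerivAt_id t).smul_const (y - x)).const_add x).hasDerivWithinAt
    have hcomp := (hgrad _ (hmem t ht)).hasFDerivWithinAt.comp_hasDerivWithinAt t hline hmem
    have hlin := ((hasDerivAt_id t).mul_const (inner ℝ (f' x) (y - x))).hasDerivWithinAt
      (s := Set.Icc 0 1)
    exact ((hcomp.sub_const (f x)).sub hlin).congr_deriv (by simp)
  have hbound := image_norm_le_of_norm_deriv_right_le_deriv_boundary
    (B := fun t => K / 2 * ‖y - x‖ ^ 2 * t ^ 2) (B' := fun t => K * ‖y - x‖ ^ 2 * t)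
    (fun t ht => (hder t ht).continuousWithinAt)
    (fun t ht => (hder t (Set.Ico_subset_Icc_self ht)).mono_of_mem_nhdsWithin
      (Icc_mem_nhdsGE_of_mem ht)) (by simp)
    (fun t => ((hasDerivAt_pow 2 t).const_mul (K / 2 * ‖y - x‖ ^ 2)).congr_deriv (by
      push_cast; ring))
    (fun t ht => by
      rw [← inner_sub_left]
      refine (norm_inner_le_norm _ _).trans ?_
      have h := hlip _ (hmem t (Set.Ico_subset_Icc_self ht)) x hx
      rw [add_sub_cancel_left, norm_smul, Real.norm_of_nonneg ht.1] at h
      calc _ ≤ K * (t * ‖y - x‖) * ‖y - x‖ := by gcongr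
        _ = _ := by ring)
    (Set.right_mem_Icc.2 zero_le_one)
  simpa using hbound

/-- If `|E|` is bounded by each quadratic `L * (1 + s ^ 2) / 2 ± s * δ` with `|s| ≤ 1`,
optimising in `s` bounds `|E| + √(E ^ 2 + δ ^ 2)`. -/
theorem abs_add_sqrt_le_of_forall_quadratic_bound {E δ L : ℝ} (hδ : |δ| ≤ L)
    (h : ∀ s, |s| ≤ 1 → |E + s * δ| ≤ L * (1 + s ^ 2) / 2) :
    |E| + √(E ^ 2 + δ ^ 2) ≤ L := by
  have hL : 0 ≤ L := (abs_nonneg δ).trans hδ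
  have h0 : |E| ≤ L / 2 := by simpa using h 0 (by simp)
  have hδL : L * (δ / L) = δ := by
    rcases hL.eq_or_lt with rfl | hpos
    · simpa using (abs_nonpos_iff.1 hδ).symm
    · field_simp
  have hs : |δ / L| ≤ 1 := by
    rw [abs_div, abs_of_nonneg hL]
    exact div_le_one_of_le₀ hδ hL
  have h1 := (abs_le.1 (h (δ / L) hs)).2
  have h2 := (abs_le.1 (h (-(δ / L)) (by rwa [abs_neg]))).1
  set s := δ / L
  have hkey : 2 * |E| ≤ L * (1 - s ^ 2) := by
    rw [← hδL] at h1 h2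
    rcases abs_cases E with ⟨hE, -⟩ | ⟨hE, -⟩ <;> rw [hE] <;> nlinarith
  have hsqrt : √(E ^ 2 + δ ^ 2) ≤ L - |E| := by
    refine Real.sqrt_le_iff.2 ⟨by linarith, ?_⟩
    have := mul_le_mul_of_nonneg_left hkey hL
    rw [← hδL]
    nlinarith [sq_abs E]
  linarith

/-- Let `D = [a, b] ⊂ ℝ^N` be a hyperinterval, `f` differentiable on `D` with
gradient `f'` that is `K`-Lipschitz on `D` (Euclidean norm), and let `D_i = [a_i, b_i] ⊆ D`
be a sub-hyperinterval with `a_i ≠ b_i` and diagonal length `Δ_i = ‖a_i - b_i‖`.  With the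
directional derivatives `da`, `db` of `f` along the main diagonal at the two vertices and
`E_i = 2(f a_i - f b_i) + (da + db)Δ_i`, `d_i = √(E_i² + (db - da)²Δ_i²)`,
`w_i = (|E_i| + d_i)/Δ_i²`, one has `w_i ≤ K`. -/
theorem per_interval_estimate_le_gradient_lipschitz_constant
    {N : ℕ} (a b ai bi : EuclideanSpace ℝ (Fin N)) (K : ℝ)
    (f : EuclideanSpace ℝ (Fin N) → ℝ)
    (f' : EuclideanSpace ℝ (Fin N) → EuclideanSpace ℝ (Fin N))
    (D Di : Set (EuclideanSpace ℝ (Fin N)))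
    (hD : D = {x | ∀ j, a j ≤ x j ∧ x j ≤ b j})
    (hDi : Di = {x | ∀ j, ai j ≤ x j ∧ x j ≤ bi j})
    (hsub : Di ⊆ D)
    (hgrad : ∀ x ∈ D, HasGradientWithinAt f (f' x) D x)
    (hlip : ∀ x' ∈ D, ∀ x'' ∈ D, ‖f' x' - f' x''‖ ≤ K * ‖x' - x''‖)
    (hne : ai ≠ bi) (hile : ∀ j, ai j ≤ bi j)
    (Δi : ℝ) (hΔi : Δi = ‖ai - bi‖)
    (da db E d w : ℝ)
    (hda : da = (∑ j, f' ai j * (bi j - ai j)) / Δi)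
    (hdb : db = (∑ j, f' bi j * (bi j - ai j)) / Δi)
    (hE : E = 2 * (f ai - f bi) + (da + db) * Δi)
    (hd : d = Real.sqrt (E ^ 2 + (db - da) ^ 2 * Δi ^ 2))
    (hw : w = (|E| + d) / Δi ^ 2) :
    w ≤ K := by
  have hconv : Convex ℝ D := by
    rw [hD]
    intro x hx y hy s t hs ht hst j
    exact convex_Icc (a j) (b j) (hx j) (hy j) hs ht hst
  have hai : ai ∈ D := hsub (by rw [hDi]; exact fun j => ⟨le_rfl, hile j⟩)
  have hbi : bi ∈ D := hsub (by rw [hDi]; exact fun j => ⟨hile j, le_rfl⟩)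
  have hpos : 0 < Δi := by rw [hΔi]; exact norm_pos_iff.2 (sub_ne_zero.2 hne)
  have hΔ : ‖bi - ai‖ = Δi := by rw [hΔi, norm_sub_rev]
  have hinner : ∀ v : EuclideanSpace ℝ (Fin N),
      ∑ j, v j * (bi j - ai j) = inner ℝ v (bi - ai) := by
    intro v
    simp [PiLp.inner_apply, mul_comm]
  have hga : da * Δi = inner ℝ (f' ai) (bi - ai) := by
    rw [hda, hinner, div_mul_cancel₀ _ hpos.ne']
  have hgb : db * Δi = inner ℝ (f' bi) (bi - ai) := by
    rw [hdb, hinner, div_mul_cancel₀ _ hpos.ne']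
  have hδ : |(db - da) * Δi| ≤ K * Δi ^ 2 := by
    rw [sub_mul, hga, hgb, ← inner_sub_left]
    refine (abs_real_inner_le_norm _ _).trans ?_
    have h := hlip bi hbi ai hai
    rw [hΔ] at h ⊢
    nlinarith
  rw [hw, div_le_iff₀ (by positivity), hd, ← mul_pow]
  refine abs_add_sqrt_le_of_forall_quadratic_bound hδ fun s hs => ?_
  obtain ⟨hs1, hs2⟩ := abs_le.1 hs
  have hc : (1 - s) / 2 ∈ Set.Icc (0 : ℝ) 1 := ⟨by linarith, by linarith⟩
  have hm := hconv.add_smul_sub_mem hai hbi hc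
  have h1 := abs_sub_sub_inner_le_of_gradient_lipschitz hconv hgrad hlip hai hm
  have h2 := abs_sub_sub_inner_le_of_gradient_lipschitz hconv hgrad hlip hbi hm
  have hdiff : ai + ((1 - s) / 2) • (bi - ai) - bi = (-((1 + s) / 2)) • (bi - ai) := by
    module
  rw [add_sub_cancel_left, inner_smul_right, norm_smul, ← hga, mul_pow, hΔ, Real.norm_eq_abs,
    sq_abs] at h1
  rw [hdiff, inner_smul_right, norm_smul, ← hgb, mul_pow, hΔ, Real.norm_eq_abs, sq_abs] at h2
  rw [abs_le] at h1 h2 ⊢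
  obtain ⟨h1l, h1u⟩ := h1
  obtain ⟨h2l, h2u⟩ := h2
  rw [hE]
  constructor <;> linarith
end

section
/- Let Δ > 0, let g : ℝ → ℝ have a K-Lipschitz derivative on [0, Δ], and let m be a constant with m ≥ K, m > 0, and m·Δ + g'(Δ) − g'(0) ≠ 0. Define y = Δ/4 + (g'(Δ) − g'(0))/(4m) + (g(0) − g(Δ) + g'(Δ)Δ + 0.5·m·Δ²)/(m·Δ + g'(Δ) − g'(0)), y' = −Δ/4 − (g'(Δ) − g'(0))/(4m) + (g(0) − g(Δ) + g'(Δ)Δ + 0.5·m·Δ²)/(m·Δ + g'(Δ) − g'(0)), and B = g'(Δ) − 2·m·y + m·Δ. Suppose the sign condition (m·y + B)·(m·y' + B) < 0 holds. Define x̂ = 2y − g'(Δ)/m − Δ and φ̂ = g(Δ) − g'(Δ)Δ − 0.5·m·Δ² + m·y² − 0.5·m·x̂². Then for every x ∈ [0, Δ], min{g(0), φ̂, g(Δ)} ≤ g(x); that is, the characteristic R = min{g(0), φ̂, g(Δ)} computed in Step 2.2 of the SmoothD algorithm is a lower bound on g over the interval [0, Δ]. -/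
/-- Mean value theorem for a function differentiable within `[a, b]`, with the two points in either
order. -/
theorem exists_mem_uIcc_sub_eq_mul_sub {a b : ℝ} {f f' : ℝ → ℝ}
    (hf : ∀ x ∈ Set.Icc a b, HasDerivWithinAt f (f' x) (Set.Icc a b) x)
    {p q : ℝ} (hp : p ∈ Set.Icc a b) (hq : q ∈ Set.Icc a b) :
    ∃ c ∈ Set.uIcc q p, f p - f q = f' c * (p - q) := by
  wlog hqp : q ≤ p generalizing p q
  · obtain ⟨c, hc, h⟩ := this hq hp (le_of_not_ge hqp)
    exact ⟨c, Set.uIcc_comm q p ▸ hc, by linarith⟩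
  rcases hqp.eq_or_lt with rfl | hlt
  · exact ⟨q, Set.left_mem_uIcc, by simp⟩
  have hsub : Set.Icc q p ⊆ Set.Icc a b := Set.Icc_subset_Icc hq.1 hp.2
  obtain ⟨c, hc, h⟩ := exists_hasDerivAt_eq_slope f f' hlt
    (fun x hx => ((hf x (hsub hx)).mono hsub).continuousWithinAt)
    (fun x hx => (hf x (hsub (Set.Ioo_subset_Icc_self hx))).hasDerivAt
      (Icc_mem_nhds (hq.1.trans_lt hx.1) (hx.2.trans_le hp.2)))
  refine ⟨c, Set.Icc_subset_uIcc (Set.Ioo_subset_Icc_self hc), ?_⟩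
  rw [h, div_mul_cancel₀ _ (sub_ne_zero.2 hlt.ne')]

/-- Quadratic upper bound for a function with `m`-Lipschitz derivative. -/
theorem le_quadratic_of_lipschitz_deriv {a b m : ℝ} {f f' : ℝ → ℝ}
    (hf : ∀ x ∈ Set.Icc a b, HasDerivWithinAt f (f' x) (Set.Icc a b) x)
    (hlip : ∀ x ∈ Set.Icc a b, ∀ z ∈ Set.Icc a b, |f' x - f' z| ≤ m * |x - z|)
    {p q : ℝ} (hp : p ∈ Set.Icc a b) (hq : q ∈ Set.Icc a b) :
    f p ≤ f q + f' q * (p - q) + m / 2 * (p - q) ^ 2 := by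
  have hder : ∀ x ∈ Set.Icc a b,
      HasDerivWithinAt (fun z => f z - f' q * (z - q) - m / 2 * (z - q) ^ 2)
        (f' x - f' q - m * (x - q)) (Set.Icc a b) x := by
    intro x hx
    have hlin := (hasDerivWithinAt_id x (Set.Icc a b)).sub_const q
    refine (((hf x hx).sub (hlin.const_mul (f' q))).sub
      ((hlin.pow 2).const_mul (m / 2))).congr_deriv ?_
    norm_num
    ring
  obtain ⟨c, hc, h⟩ := exists_mem_uIcc_sub_eq_mul_sub hder hp hq
  have hbound := abs_le.1 (hlip c (Set.uIcc_subset_Icc hq hp hc) q hq)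
  simp only [sub_self] at h
  have : (f' c - f' q - m * (c - q)) * (p - q) ≤ 0 := by
    rcases le_total q p with hqp | hqp
    · rw [Set.uIcc_of_le hqp] at hc
      rw [abs_of_nonneg (sub_nonneg.2 hc.1)] at hbound
      exact mul_nonpos_of_nonpos_of_nonneg (by linarith) (sub_nonneg.2 hqp)
    · rw [Set.uIcc_of_ge hqp] at hc
      rw [abs_of_nonpos (sub_nonpos.2 hc.2)] at hbound
      exact mul_nonpos_of_nonneg_of_nonpos (by linarith) (sub_nonpos.2 hqp)
  linarith

/-- Quadratic lower bound for a function with `m`-Lipschitz derivative. -/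
theorem quadratic_le_of_lipschitz_deriv {a b m : ℝ} {f f' : ℝ → ℝ}
    (hf : ∀ x ∈ Set.Icc a b, HasDerivWithinAt f (f' x) (Set.Icc a b) x)
    (hlip : ∀ x ∈ Set.Icc a b, ∀ z ∈ Set.Icc a b, |f' x - f' z| ≤ m * |x - z|)
    {p q : ℝ} (hp : p ∈ Set.Icc a b) (hq : q ∈ Set.Icc a b) :
    f q + f' q * (p - q) - m / 2 * (p - q) ^ 2 ≤ f p := by
  have h := le_quadratic_of_lipschitz_deriv (f := -f) (f' := -f') (m := m)
    (fun x hx => (hf x hx).neg)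
    (fun x hx z hz => by
      rw [Pi.neg_apply, Pi.neg_apply, neg_sub_neg, abs_sub_comm]
      exact hlip x hx z hz) hp hq
  simp only [Pi.neg_apply] at h
  linarith

/-- A concave parabola on `[0, t]` is bounded below by the minimum of its endpoint values. -/
theorem min_le_concave_quadratic {c d m t x : ℝ} (hm : 0 ≤ m) (hx : 0 ≤ x) (hxt : x ≤ t) :
    min c (c + d * t - m / 2 * t ^ 2) ≤ c + d * x - m / 2 * x ^ 2 := by
  rcases le_or_gt 0 (d - m / 2 * x) with h | h
  · exact (min_le_left _ _).trans (by nlinarith [mul_nonneg h hx])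
  · refine (min_le_right _ _).trans ?_
    have h' : d - m / 2 * x - m / 2 * t ≤ 0 := by
      nlinarith [mul_nonneg hm (hx.trans hxt)]
    nlinarith [mul_nonneg (neg_nonneg.2 h') (sub_nonneg.2 hxt)]

/-- If `g : ℝ → ℝ` has a `K`-Lipschitz derivative `g'` on `[0, Δ]` (`Δ > 0`),
`m ≥ K`, `m > 0`, `mΔ + g' Δ - g' 0 ≠ 0`, and with `y`, `y'`, `B`, `x̂`, `φ̂` defined by the
Step 2 formulas of the SmoothD algorithm, the sign condition `(my + B)(my' + B) < 0` holds,
then the characteristic `R = min {g 0, φ̂, g Δ}` is a lower bound for `g` on `[0, Δ]`. -/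
theorem characteristic_is_lower_bound
    (Δ K m : ℝ) (hΔ : 0 < Δ) (g g' : ℝ → ℝ)
    (hderiv : ∀ x ∈ Set.Icc (0 : ℝ) Δ, HasDerivWithinAt g (g' x) (Set.Icc (0 : ℝ) Δ) x)
    (hlip : ∀ x' ∈ Set.Icc (0 : ℝ) Δ, ∀ x'' ∈ Set.Icc (0 : ℝ) Δ,
      |g' x' - g' x''| ≤ K * |x' - x''|)
    (hmK : K ≤ m) (hm : 0 < m) (hne : m * Δ + g' Δ - g' 0 ≠ 0)
    (y y' B xhat phihat : ℝ)
    (hy : y = Δ / 4 + (g' Δ - g' 0) / (4 * m) +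
      (g 0 - g Δ + g' Δ * Δ + 0.5 * m * Δ ^ 2) / (m * Δ + g' Δ - g' 0))
    (hy' : y' = -(Δ / 4) - (g' Δ - g' 0) / (4 * m) +
      (g 0 - g Δ + g' Δ * Δ + 0.5 * m * Δ ^ 2) / (m * Δ + g' Δ - g' 0))
    (hB : B = g' Δ - 2 * m * y + m * Δ)
    (hsign : (m * y + B) * (m * y' + B) < 0)
    (hxhat : xhat = 2 * y - g' Δ / m - Δ)
    (hphihat : phihat = g Δ - g' Δ * Δ - 0.5 * m * Δ ^ 2 + m * y ^ 2 - 0.5 * m * xhat ^ 2) :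
    ∀ x ∈ Set.Icc (0 : ℝ) Δ, min (min (g 0) phihat) (g Δ) ≤ g x := by
  have hlip' : ∀ x ∈ Set.Icc (0 : ℝ) Δ, ∀ z ∈ Set.Icc (0 : ℝ) Δ,
      |g' x - g' z| ≤ m * |x - z| := fun x hx z hz =>
    (hlip x hx z hz).trans (mul_le_mul_of_nonneg_right hmK (abs_nonneg _))
  have h0 : (0 : ℝ) ∈ Set.Icc (0 : ℝ) Δ := ⟨le_rfl, hΔ.le⟩
  have h1 : Δ ∈ Set.Icc (0 : ℝ) Δ := ⟨hΔ.le, le_rfl⟩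
  have upper {p q : ℝ} (hp : p ∈ Set.Icc 0 Δ) (hq : q ∈ Set.Icc 0 Δ) :=
    le_quadratic_of_lipschitz_deriv hderiv hlip' hp hq
  have lower {p q : ℝ} (hp : p ∈ Set.Icc 0 Δ) (hq : q ∈ Set.Icc 0 Δ) :=
    quadratic_le_of_lipschitz_deriv hderiv hlip' hp hq
  have habs := abs_le.1 (hlip' Δ h1 0 h0)
  rw [sub_zero, abs_of_pos hΔ] at habs
  have hdiff : 2 * m * (y - y') = m * Δ + g' Δ - g' 0 := by
    rw [hy, hy']; field_simp; ring
  have hcont : g 0 - g Δ + g' Δ * Δ + m / 2 * Δ ^ 2 = m * (y ^ 2 - y' ^ 2) := by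
    have hsum : (y + y') * (m * Δ + g' Δ - g' 0) =
        2 * (g 0 - g Δ + g' Δ * Δ + 0.5 * m * Δ ^ 2) := by
      have : y + y' = 2 * ((g 0 - g Δ + g' Δ * Δ + 0.5 * m * Δ ^ 2) /
          (m * Δ + g' Δ - g' 0)) := by
        rw [hy, hy']; ring
      rw [this, mul_assoc, div_mul_cancel₀ _ hne]
    rw [← hdiff] at hsum
    linarith
  have ht : 0 < y - y' := by
    have : 0 < 2 * m * (y - y') := by
      rw [hdiff]; exact lt_of_le_of_ne (by linarith) (Ne.symm hne)
    exact pos_of_mul_pos_right this (by positivity)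
  have htΔ : y - y' ≤ Δ := by
    refine le_of_mul_le_mul_left (a := 2 * m) ?_ (by positivity)
    linarith
  have hb : g' Δ = B + 2 * m * y - m * Δ := by linarith
  have ha : g' 0 = B + 2 * m * y' := by linarith
  have hx' : m * xhat = -B := by
    rw [hxhat, hB]; field_simp; ring
  -- `φ x = φhat + m / 2 * (x - xhat) ^ 2` is the middle quadratic piece.
  have hφ (x : ℝ) : phihat + m / 2 * (x - xhat) ^ 2 =
      g 0 + m * y' ^ 2 + B * x + m / 2 * x ^ 2 := by
    linear_combination hphihat - x * hx' - hcont
  have hφ' (x : ℝ) : phihat ≤ g 0 + m * y' ^ 2 + B * x + m / 2 * x ^ 2 := by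
    rw [← hφ]; linarith [mul_nonneg (half_pos hm).le (sq_nonneg (x - xhat))]
  have hg1 : g Δ = g 0 + m * y' ^ 2 + B * Δ + m / 2 * Δ ^ 2 - m * (Δ - y) ^ 2 := by
    rw [hb] at hcont; linarith
  have hy'0 : 0 ≤ y' := by
    have hs : y - y' ∈ Set.Icc 0 Δ := ⟨ht.le, htΔ⟩
    have hl := lower hs h1
    have hu := upper hs h0
    rw [hb, hg1] at hl
    rw [ha] at hu
    have : 0 ≤ 2 * m * (y - y') * y' := by linarith
    exact nonneg_of_mul_nonneg_right this (by positivity)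
  have hyΔ : y ≤ Δ := by
    have hs : Δ - (y - y') ∈ Set.Icc 0 Δ := ⟨by linarith, by linarith⟩
    have hl := lower hs h0
    have hu := upper hs h1
    rw [hb, hg1] at hu
    rw [ha] at hl
    have : 0 ≤ 2 * m * (y - y') * (Δ - y) := by linarith
    exact sub_nonneg.1 (nonneg_of_mul_nonneg_right this (by positivity))
  intro x hx
  have hl0 := lower hx h0
  have hl1 := lower hx h1
  rcases le_total x y' with hxy' | hxy'
  · have hmin := min_le_concave_quadratic (c := g 0) (d := g' 0) hm.le hx.1 hxy'
    have hval : phihat ≤ g 0 + g' 0 * y' - m / 2 * y' ^ 2 := by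
      rw [ha]; linarith [hφ' y']
    calc min (min (g 0) phihat) (g Δ) ≤ min (g 0) phihat := min_le_left _ _
      _ ≤ _ := min_le_min_left _ hval
      _ ≤ _ := hmin
      _ ≤ g x := by linarith
  rcases le_total y x with hyx | hxy
  · have hmin := min_le_concave_quadratic (c := g Δ) (d := -g' Δ) hm.le
      (sub_nonneg.2 hx.2) (sub_le_sub_left hyx Δ)
    have hval : phihat ≤ g Δ + -g' Δ * (Δ - y) - m / 2 * (Δ - y) ^ 2 := by
      rw [hb, hg1]; linarith [hφ' y]
    calc min (min (g 0) phihat) (g Δ) ≤ min phihat (g Δ) := min_le_min_right _ (min_le_right _ _)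
      _ = min (g Δ) phihat := min_comm _ _
      _ ≤ _ := min_le_min_left _ hval
      _ ≤ _ := hmin
      _ ≤ g x := by linarith
  · have hmem' : y' ∈ Set.Icc 0 Δ := ⟨hy'0, by linarith⟩
    have hmem : y ∈ Set.Icc 0 Δ := ⟨by linarith, hyΔ⟩
    have hu' := upper hmem' hx
    have hu := upper hmem hx
    have hl' := lower hmem' h0
    have hl := lower hmem h1
    rw [ha] at hl'
    rw [hb, hg1] at hl
    have key' : 0 ≤ (g x - (g 0 + m * y' ^ 2 + B * x + m / 2 * x ^ 2)) +
        (g' x - (m * x + B)) * (y' - x) := by linarith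
    have key : 0 ≤ (g x - (g 0 + m * y' ^ 2 + B * x + m / 2 * x ^ 2)) +
        (g' x - (m * x + B)) * (y - x) := by linarith
    have hmid : 0 ≤ g x - (g 0 + m * y' ^ 2 + B * x + m / 2 * x ^ 2) := by
      rcases le_total 0 (g' x - (m * x + B)) with hs | hs
      · linarith [mul_nonneg hs (sub_nonneg.2 hxy')]
      · linarith [mul_nonneg (neg_nonneg.2 hs) (sub_nonneg.2 hxy)]
    calc min (min (g 0) phihat) (g Δ) ≤ phihat := (min_le_left _ _).trans (min_le_right _ _)
      _ ≤ g x := by linarith [hφ' x]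
end

section
/- Let D₀ ⊇ D₁ ⊇ D₂ ⊇ … be a sequence of hyperintervals in ℝ^N such that D₀ = [a, b] with a ≠ b and, for every k ≥ 0, D_{k+1} is one of the three hyperintervals obtained from D_k by trisecting D_k along a coordinate realizing its maximal side length (replacing that coordinate range by one of its three equal thirds, keeping the other coordinate ranges). Let Δ_k denote the main diagonal length of D_k (Euclidean norm). Then Δ_k ≤ (1 − 8/(9N))^{k/2}·Δ₀ for all k, and consequently Δ_k → 0 as k → ∞. -/
/-- Dividing a maximal entry of a nonnegative vector by three contracts the squared norm. -/
theorem norm_sq_le_of_maximal_entry_div_three {N : ℕ} {x y : EuclideanSpace ℝ (Fin N)}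
    {i : Fin N} (hx : ∀ j, 0 ≤ x j) (hmax : ∀ j, x j ≤ x i) (hi : y i = x i / 3)
    (hne : ∀ j, j ≠ i → y j = x j) :
    ‖y‖ ^ 2 ≤ (1 - 8 / (9 * (N : ℝ))) * ‖x‖ ^ 2 := by
  have hN : (0 : ℝ) < N := Nat.cast_pos.mpr i.pos
  have hsum : ‖x‖ ^ 2 ≤ N * x i ^ 2 := by
    rw [EuclideanSpace.real_norm_sq_eq]
    calc ∑ j, x j ^ 2 ≤ ∑ _j : Fin N, x i ^ 2 :=
          Finset.sum_le_sum fun j _ => pow_le_pow_left₀ (hx j) (hmax j) 2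
      _ = N * x i ^ 2 := by simp
  have hy : ‖y‖ ^ 2 = ‖x‖ ^ 2 - 8 / 9 * x i ^ 2 := by
    have hcoord : ∀ j, y j ^ 2 = x j ^ 2 - if j = i then 8 / 9 * x i ^ 2 else 0 := by
      intro j
      split_ifs with h
      · rw [h, hi]; ring
      · rw [hne j h, sub_zero]
    simp [EuclideanSpace.real_norm_sq_eq, hcoord]
  have hscaled : 8 / (9 * (N : ℝ)) * ‖x‖ ^ 2 ≤ 8 / 9 * x i ^ 2 :=
    calc 8 / (9 * (N : ℝ)) * ‖x‖ ^ 2 ≤ 8 / (9 * (N : ℝ)) * (N * x i ^ 2) := by gcongr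
      _ = 8 / 9 * x i ^ 2 := by field_simp
  linarith

/-- Let `D₀ ⊇ D₁ ⊇ D₂ ⊇ …` be a nested sequence of hyperintervals in `ℝ^N`,
`D_k = [a k, b k]`, with `a 0 ≠ b 0`, where each `D_{k+1}` is one of the three
hyperintervals obtained from `D_k` by trisecting it along a coordinate realizing its
maximal side length.  Then the diagonal lengths satisfy
`Δ_k ≤ (1 - 8/(9N))^{k/2} Δ₀` and hence `Δ_k → 0`. -/
theorem nested_trisection_diagonals_tend_to_zero
    {N : ℕ} (a b : ℕ → EuclideanSpace ℝ (Fin N))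
    (h0ne : a 0 ≠ b 0) (h0le : ∀ j, a 0 j ≤ b 0 j)
    (hstep : ∀ k, ∃ i : Fin N,
      (∀ j, b k j - a k j ≤ b k i - a k i) ∧
      ∃ t : Fin 3,
        a (k + 1) i = a k i + (t : ℝ) * (b k i - a k i) / 3 ∧
        b (k + 1) i = a k i + ((t : ℝ) + 1) * (b k i - a k i) / 3 ∧
        ∀ j, j ≠ i → a (k + 1) j = a k j ∧ b (k + 1) j = b k j) :
    (∀ k : ℕ, ‖b k - a k‖ ≤ (1 - 8 / (9 * (N : ℝ))) ^ ((k : ℝ) / 2) * ‖b 0 - a 0‖) ∧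
    Filter.Tendsto (fun k : ℕ => ‖b k - a k‖) Filter.atTop (nhds 0) := by
  obtain ⟨i₀, -⟩ := hstep 0
  have hN : (1 : ℝ) ≤ N := Nat.one_le_cast.mpr i₀.pos
  set c : ℝ := 1 - 8 / (9 * (N : ℝ)) with hc
  have hc_pos : 0 < c := by
    rw [hc, sub_pos, div_lt_one (by positivity)]
    linarith
  have hc_lt : c < 1 := sub_lt_self _ (by positivity)
  have hsides : ∀ k j, 0 ≤ (b k - a k) j := by
    intro k
    induction k with
    | zero => exact fun j => sub_nonneg.mpr (h0le j)
    | succ k ih =>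
      obtain ⟨i, -, t, ha, hb, hne⟩ := hstep k
      intro j
      have hj := ih j
      simp only [PiLp.sub_apply] at hj ⊢
      by_cases h : j = i
      · subst h
        rw [ha, hb]
        linarith
      · rwa [(hne j h).1, (hne j h).2]
  have hcontract : ∀ k, ‖b (k + 1) - a (k + 1)‖ ^ 2 ≤ c * ‖b k - a k‖ ^ 2 := by
    intro k
    obtain ⟨i, hmax, t, ha, hb, hne⟩ := hstep k
    refine norm_sq_le_of_maximal_entry_div_three (i := i) (hsides k) hmax ?_ fun j hj => ?_
    · simp only [PiLp.sub_apply, ha, hb]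
      ring
    · simp only [PiLp.sub_apply, hne j hj]
  have hsq : ∀ k : ℕ, ‖b k - a k‖ ^ 2 ≤ c ^ k * ‖b 0 - a 0‖ ^ 2 := by
    intro k
    induction k with
    | zero => simp
    | succ k ih =>
      calc ‖b (k + 1) - a (k + 1)‖ ^ 2 ≤ c * ‖b k - a k‖ ^ 2 := hcontract k
        _ ≤ c * (c ^ k * ‖b 0 - a 0‖ ^ 2) := by gcongr
        _ = c ^ (k + 1) * ‖b 0 - a 0‖ ^ 2 := by ring
  have hbound : ∀ k : ℕ, ‖b k - a k‖ ≤ c ^ ((k : ℝ) / 2) * ‖b 0 - a 0‖ := by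
    intro k
    refine (sq_le_sq₀ (norm_nonneg _) (by positivity)).mp ?_
    rw [mul_pow, ← Real.rpow_mul_natCast hc_pos.le, Nat.cast_ofNat,
      div_mul_cancel₀ _ (two_ne_zero' ℝ), Real.rpow_natCast]
    exact hsq k
  refine ⟨hbound, squeeze_zero (fun k => norm_nonneg _) hbound ?_⟩
  have hexp : Filter.Tendsto (fun k : ℕ => (k : ℝ) / 2) Filter.atTop Filter.atTop :=
    tendsto_natCast_atTop_atTop.atTop_div_const two_pos
  simpa using ((tendsto_rpow_atTop_of_base_lt_one c (by linarith) hc_lt).comp hexp).mul_const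
    ‖b 0 - a 0‖
end

section
/- Let D = [a, b] ⊂ ℝ^N be a hyperinterval, let f : ℝ^N → ℝ be differentiable on D with gradient f' satisfying ‖f'(x') − f'(x'')‖ ≤ K‖x' − x''‖ for all x', x'' ∈ D (Euclidean norm), and let D_i = [a_i, b_i] ⊆ D be a sub-hyperinterval with a_i ≠ b_i and main diagonal length Δ_i = ‖a_i − b_i‖. Let g(t) = f(a_i + (t/Δ_i)(b_i − a_i)) for t ∈ [0, Δ_i], and let m ≥ K with m > 0 and m·Δ_i + g'(Δ_i) − g'(0) ≠ 0. With y, y', B, x̂, φ̂ defined from g(0), g(Δ_i), g'(0), g'(Δ_i), Δ_i, m by the Step 2 formulas of the SmoothD algorithm (y = Δ_i/4 + (g'(Δ_i) − g'(0))/(4m) + (g(0) − g(Δ_i) + g'(Δ_i)Δ_i + 0.5mΔ_i²)/(mΔ_i + g'(Δ_i) − g'(0)); y' = −Δ_i/4 − (g'(Δ_i) − g'(0))/(4m) + (g(0) − g(Δ_i) + g'(Δ_i)Δ_i + 0.5mΔ_i²)/(mΔ_i + g'(Δ_i) − g'(0)); B = g'(Δ_i) − 2my + mΔ_i; x̂ =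 2y − g'(Δ_i)/m − Δ_i; φ̂ = g(Δ_i) − g'(Δ_i)Δ_i − 0.5mΔ_i² + my² − 0.5m·x̂²), and assuming the sign condition (my + B)(my' + B) < 0, the characteristic R_i = min{f(a_i), φ̂, f(b_i)} satisfies R_i ≤ f(x) for every point x on the main diagonal segment {a_i + t·(b_i − a_i) : t ∈ [0, 1]} of D_i. -/
/-- A function with a monotone derivative on a closed interval is convex there. -/
theorem convexOn_Icc_of_hasDerivWithinAt {l r : ℝ} {f p : ℝ → ℝ}
    (hf : ∀ t ∈ Set.Icc l r, HasDerivWithinAt f (p t) (Set.Icc l r) t)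
    (hp : MonotoneOn p (Set.Icc l r)) : ConvexOn ℝ (Set.Icc l r) f := by
  have hd : ∀ t ∈ interior (Set.Icc l r), HasDerivAt f (p t) t := fun t ht =>
    (hf t (interior_subset ht)).hasDerivAt (mem_interior_iff_mem_nhds.mp ht)
  refine MonotoneOn.convexOn_of_deriv (convex_Icc l r)
    (fun t ht => (hf t ht).continuousWithinAt)
    (fun t ht => (hd t ht).differentiableAt.differentiableWithinAt) ?_
  intro s hs t ht hst
  rw [(hd s hs).deriv, (hd t ht).deriv]
  exact hp (interior_subset hs) (interior_subset ht) hst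

/-- A differentiable convex function lies above its tangent lines. -/
theorem ConvexOn.tangent_le_of_hasDerivWithinAt {S : Set ℝ} {f : ℝ → ℝ} {x t d : ℝ}
    (hf : ConvexOn ℝ S f) (hx : x ∈ S) (ht : t ∈ S) (hd : HasDerivWithinAt f d S x) :
    f x + d * (t - x) ≤ f t := by
  rcases lt_trichotomy x t with h | rfl | h
  · have := hf.le_slope_of_hasDerivWithinAt hx ht h hd
    rw [slope_def_field, le_div_iff₀ (sub_pos.mpr h)] at this
    linarith
  · simp
  · have := hf.slope_le_of_hasDerivWithinAt ht hx h hd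
    rw [slope_def_field, div_le_iff₀ (sub_pos.mpr h)] at this
    linarith

/-- A concave parabola on `[0, T]` attains its minimum at an endpoint. -/
theorem min_le_concave_parabola {m v d t T : ℝ} (hm : 0 ≤ m) (ht : 0 ≤ t) (htT : t ≤ T) :
    min v (v + d * T - m * T ^ 2 / 2) ≤ v + d * t - m * t ^ 2 / 2 := by
  rcases le_total (m * T / 2) d with h | h
  · refine (min_le_left _ _).trans ?_
    nlinarith [mul_le_mul_of_nonneg_left htT hm]
  · refine (min_le_right _ _).trans ?_
    nlinarith [mul_nonneg (sub_nonneg.mpr htT) (sub_nonneg.mpr h),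
      mul_nonneg (sub_nonneg.mpr htT) (mul_nonneg hm ht)]

/-- Let `g` have an `m`-Lipschitz derivative `p` on `[0, Δ]`. If the parabola
`m t² / 2 + B t + c` touches, with equal slopes, the lower parabolas of curvature `-m` issuing
from `0` and from `Δ` at the points `y'` and `y`, then `g` is bounded below by the smaller of its
endpoint values and the minimum of that parabola. -/
theorem min_le_of_lipschitz_deriv {Δ m y y' B c : ℝ} {g p : ℝ → ℝ} (hΔ : 0 < Δ) (hm : 0 < m)
    (hg : ∀ t ∈ Set.Icc 0 Δ, HasDerivWithinAt g (p t) (Set.Icc 0 Δ) t)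
    (hp : ∀ s ∈ Set.Icc 0 Δ, ∀ t ∈ Set.Icc 0 Δ, |p s - p t| ≤ m * |s - t|)
    (hyy : y ≠ y')
    (hslope0 : p 0 = 2 * m * y' + B) (hslopeΔ : p Δ = 2 * m * y + B - m * Δ)
    (hval0 : g 0 = c - m * y' ^ 2)
    (hvalΔ : g Δ = c + p Δ * Δ + m * Δ ^ 2 / 2 - m * y ^ 2)
    {t : ℝ} (ht : t ∈ Set.Icc 0 Δ) :
    min (min (g 0) (c - B ^ 2 / (2 * m))) (g Δ) ≤ g t := by
  have h0 : (0 : ℝ) ∈ Set.Icc 0 Δ := ⟨le_rfl, hΔ.le⟩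
  have h1 : Δ ∈ Set.Icc 0 Δ := ⟨hΔ.le, le_rfl⟩
  have hdU : ∀ t ∈ Set.Icc 0 Δ,
      HasDerivWithinAt (fun t => m * t ^ 2 / 2 + g t) (m * t + p t) (Set.Icc 0 Δ) t := by
    intro t ht
    have h := (((hasDerivAt_pow 2 t).const_mul (m / 2)).hasDerivWithinAt
      (s := Set.Icc 0 Δ)).add (hg t ht)
    refine (h.congr_deriv (by push_cast; ring)).congr (fun s _ => ?_) ?_ <;>
      simp <;> ring
  have hdW : ∀ t ∈ Set.Icc 0 Δ,
      HasDerivWithinAt (fun t => m * t ^ 2 / 2 + B * t + c - g t) (m * t + B - p t)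
        (Set.Icc 0 Δ) t := by
    intro t ht
    have h := ((((((hasDerivAt_pow 2 t).const_mul (m / 2)).add
      ((hasDerivAt_id t).const_mul B)).add_const c)).hasDerivWithinAt
      (s := Set.Icc 0 Δ)).sub (hg t ht)
    refine (h.congr_deriv (by push_cast; ring)).congr (fun s _ => ?_) ?_ <;>
      simp <;> ring
  have hU := convexOn_Icc_of_hasDerivWithinAt hdU fun s hs t ht hst => by
    have := abs_le.mp (hp s hs t ht)
    rw [abs_of_nonpos (sub_nonpos.mpr hst)] at this
    linarith
  have hW := convexOn_Icc_of_hasDerivWithinAt hdW fun s hs t ht hst => by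
    have := abs_le.mp (hp s hs t ht)
    rw [abs_of_nonpos (sub_nonpos.mpr hst)] at this
    linarith
  have hlow0 : ∀ t ∈ Set.Icc 0 Δ, g 0 + p 0 * t - m * t ^ 2 / 2 ≤ g t := fun t ht => by
    have := hU.tangent_le_of_hasDerivWithinAt h0 ht (hdU 0 h0)
    linarith
  have hlowΔ : ∀ t ∈ Set.Icc 0 Δ, g Δ + p Δ * (t - Δ) - m * (t - Δ) ^ 2 / 2 ≤ g t :=
    fun t ht => by
      have := hU.tangent_le_of_hasDerivWithinAt h1 ht (hdU Δ h1)
      linarith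
  have hup0 : ∀ t ∈ Set.Icc 0 Δ, g t ≤ g 0 + p 0 * t + m * t ^ 2 / 2 := fun t ht => by
    have := hW.tangent_le_of_hasDerivWithinAt h0 ht (hdW 0 h0)
    linarith
  have hupΔ : ∀ t ∈ Set.Icc 0 Δ, g t ≤ g Δ + p Δ * (t - Δ) + m * (t - Δ) ^ 2 / 2 :=
    fun t ht => by
      have := hW.tangent_le_of_hasDerivWithinAt h1 ht (hdW Δ h1)
      linarith
  have hpd := abs_le.mp (hp Δ h1 0 h0)
  rw [sub_zero, abs_of_pos hΔ] at hpd
  have hw : 0 < y - y' := by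
    refine lt_of_le_of_ne (le_of_mul_le_mul_left ?_ hm) (sub_ne_zero.mpr hyy).symm
    linarith
  have hwΔ : y - y' ≤ Δ := le_of_mul_le_mul_left (by linarith) hm
  have hmw : 0 < 2 * m * (y - y') := by positivity
  have hy' : 0 ≤ y' := by
    have hmem : y - y' ∈ Set.Icc 0 Δ := ⟨hw.le, hwΔ⟩
    have := (hlowΔ _ hmem).trans (hup0 _ hmem)
    rw [hvalΔ, hval0, hslopeΔ, hslope0] at this
    refine le_of_mul_le_mul_left ?_ hmw
    linarith
  have hyΔ : y ≤ Δ := by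
    have hmem : Δ - (y - y') ∈ Set.Icc 0 Δ := ⟨by linarith, by linarith⟩
    have := (hlow0 _ hmem).trans (hupΔ _ hmem)
    rw [hvalΔ, hval0, hslopeΔ, hslope0] at this
    refine le_of_mul_le_mul_left ?_ hmw
    linarith
  have hquad : ∀ s, c - B ^ 2 / (2 * m) ≤ m * s ^ 2 / 2 + B * s + c := fun s => by
    have : m * s ^ 2 / 2 + B * s + c - (c - B ^ 2 / (2 * m)) = (m * s + B) ^ 2 / (2 * m) := by
      field_simp
      ring
    have : 0 ≤ (m * s + B) ^ 2 / (2 * m) := by positivity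
    linarith
  rcases le_total t y' with hty' | hty'
  · have := min_le_concave_parabola (v := g 0) (d := p 0) hm.le ht.1 hty'
    have hend : c - B ^ 2 / (2 * m) ≤ g 0 + p 0 * y' - m * y' ^ 2 / 2 := by
      rw [hval0, hslope0]
      linarith [hquad y']
    exact (min_le_left _ _).trans
      ((min_le_min_left _ hend).trans (this.trans (hlow0 t ht)))
  · rcases le_total t y with hty | hty
    · have hmem' : y' ∈ Set.Icc 0 Δ := ⟨hy', by linarith⟩
      have hmem : y ∈ Set.Icc 0 Δ := ⟨by linarith, hyΔ⟩
      have hmax := hW.le_max_of_mem_Icc hmem' hmem ⟨hty', hty⟩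
      have hWt : m * t ^ 2 / 2 + B * t + c - g t ≤ 0 := by
        refine hmax.trans (max_le ?_ ?_)
        · have := hlow0 y' hmem'
          rw [hval0, hslope0] at this
          linarith
        · have := hlowΔ y hmem
          rw [hvalΔ, hslopeΔ] at this
          linarith
      exact (min_le_left _ _).trans ((min_le_right _ _).trans (by linarith [hquad t]))
    · have := min_le_concave_parabola (v := g Δ) (d := -p Δ) hm.le (sub_nonneg.mpr ht.2)
        (sub_le_sub_left hty Δ)
      have hend : c - B ^ 2 / (2 * m) ≤
          g Δ + -p Δ * (Δ - y) - m * (Δ - y) ^ 2 / 2 := by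
        rw [hvalΔ, hslopeΔ]
        linarith [hquad y]
      rw [min_assoc, min_comm (c - _)]
      refine (min_le_right _ _).trans ((min_le_min_left _ hend).trans (this.trans ?_))
      linarith [hlowΔ t ht]


/-- Let `D = [a, b] ⊂ ℝ^N`, `f` differentiable on `D` with gradient `f'` that
is `K`-Lipschitz on `D` (Euclidean norm), `D_i = [a_i, b_i] ⊆ D` a sub-hyperinterval with
`a_i ≠ b_i` and diagonal length `Δ_i = ‖a_i - b_i‖`, and `g t = f (a_i + (t/Δ_i)(b_i - a_i))`.
With `m ≥ K`, `m > 0`, `mΔ_i + g'(Δ_i) - g'(0) ≠ 0` (where `d0 = g'(0)`, `dΔ = g'(Δ_i)` are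
the directional derivatives along the diagonal at the vertices), `y, y', B, x̂, φ̂` given by
the Step 2 formulas of the SmoothD algorithm, and the sign condition `(my + B)(my' + B) < 0`,
the characteristic `R_i = min {f a_i, φ̂, f b_i}` satisfies `R_i ≤ f x` for every point `x`
on the main diagonal of `D_i`. -/
theorem characteristic_bounds_f_on_diagonal
    {N : ℕ} (a b ai bi : EuclideanSpace ℝ (Fin N)) (K : ℝ)
    (f : EuclideanSpace ℝ (Fin N) → ℝ)
    (f' : EuclideanSpace ℝ (Fin N) → EuclideanSpace ℝ (Fin N))
    (D Di : Set (EuclideanSpace ℝ (Fin N)))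
    (hD : D = {x | ∀ j, a j ≤ x j ∧ x j ≤ b j})
    (hDi : Di = {x | ∀ j, ai j ≤ x j ∧ x j ≤ bi j})
    (hsub : Di ⊆ D)
    (hgrad : ∀ x ∈ D, HasGradientWithinAt f (f' x) D x)
    (hlip : ∀ x' ∈ D, ∀ x'' ∈ D, ‖f' x' - f' x''‖ ≤ K * ‖x' - x''‖)
    (hne : ai ≠ bi) (hile : ∀ j, ai j ≤ bi j)
    (Δi : ℝ) (hΔi : Δi = ‖ai - bi‖)
    (g : ℝ → ℝ) (hg : ∀ t, g t = f (ai + (t / Δi) • (bi - ai)))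
    (d0 dΔ : ℝ)
    (hd0 : d0 = (∑ j, f' ai j * (bi j - ai j)) / Δi)
    (hdΔ : dΔ = (∑ j, f' bi j * (bi j - ai j)) / Δi)
    (m : ℝ) (hmK : K ≤ m) (hm : 0 < m) (hne2 : m * Δi + dΔ - d0 ≠ 0)
    (y y' B xhat phihat : ℝ)
    (hy : y = Δi / 4 + (dΔ - d0) / (4 * m) +
      (g 0 - g Δi + dΔ * Δi + 0.5 * m * Δi ^ 2) / (m * Δi + dΔ - d0))
    (hy' : y' = -(Δi / 4) - (dΔ - d0) / (4 * m) +
      (g 0 - g Δi + dΔ * Δi + 0.5 * m * Δi ^ 2) / (m * Δi + dΔ - d0))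
    (hB : B = dΔ - 2 * m * y + m * Δi)
    (hsign : (m * y + B) * (m * y' + B) < 0)
    (hxhat : xhat = 2 * y - dΔ / m - Δi)
    (hphihat : phihat = g Δi - dΔ * Δi - 0.5 * m * Δi ^ 2 + m * y ^ 2 - 0.5 * m * xhat ^ 2)
    (R : ℝ) (hR : R = min (min (f ai) phihat) (f bi)) :
    ∀ t ∈ Set.Icc (0 : ℝ) 1, R ≤ f (ai + t • (bi - ai)) := by
  have hΔ : 0 < Δi := hΔi ▸ norm_pos_iff.mpr (sub_ne_zero.mpr hne)
  set v : EuclideanSpace ℝ (Fin N) := bi - ai with hv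
  have hvnorm : ‖v‖ = Δi := by rw [hΔi, hv, norm_sub_rev]
  have hmaps : ∀ s ∈ Set.Icc (0 : ℝ) Δi, ai + (s / Δi) • v ∈ D := by
    intro s hs
    apply hsub
    rw [hDi]
    intro j
    have hs0 : 0 ≤ s / Δi := div_nonneg hs.1 hΔ.le
    have hs1 : s / Δi ≤ 1 := (div_le_one hΔ).mpr hs.2
    have hj : 0 ≤ bi j - ai j := sub_nonneg.mpr (hile j)
    simp only [hv, PiLp.add_apply, PiLp.smul_apply, PiLp.sub_apply, smul_eq_mul]
    constructor <;> nlinarith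
  let p : ℝ → ℝ := fun s => inner ℝ (f' (ai + (s / Δi) • v)) (Δi⁻¹ • v)
  have hgp : ∀ s ∈ Set.Icc (0 : ℝ) Δi, HasDerivWithinAt g (p s) (Set.Icc 0 Δi) s := by
    intro s hs
    have hline : HasDerivWithinAt (fun s : ℝ => ai + (s / Δi) • v) (Δi⁻¹ • v)
        (Set.Icc 0 Δi) s := by
      have h := ((((hasDerivAt_id s).div_const Δi).smul_const v).const_add ai).hasDerivWithinAt
        (s := Set.Icc 0 Δi)
      simpa using h
    have h := (hgrad _ (hmaps s hs)).hasFDerivWithinAt.comp_hasDerivWithinAt s hline hmaps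
    rw [InnerProductSpace.toDual_apply_apply] at h
    rwa [show g = f ∘ fun s : ℝ => ai + (s / Δi) • v from funext hg]
  have hpLip : ∀ s ∈ Set.Icc (0 : ℝ) Δi, ∀ t ∈ Set.Icc (0 : ℝ) Δi,
      |p s - p t| ≤ m * |s - t| := by
    intro s hs t ht
    have hunit : ‖Δi⁻¹ • v‖ = 1 := by
      rw [norm_smul, hvnorm, norm_inv, Real.norm_of_nonneg hΔ.le, inv_mul_cancel₀ hΔ.ne']
    have hdist : ‖ai + (s / Δi) • v - (ai + (t / Δi) • v)‖ = |s - t| := by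
      rw [add_sub_add_left_eq_sub, ← sub_smul, ← sub_div, norm_smul, hvnorm, norm_div,
        Real.norm_of_nonneg hΔ.le, div_mul_cancel₀ _ hΔ.ne', Real.norm_eq_abs]
    calc |p s - p t|
        = |inner ℝ (f' (ai + (s / Δi) • v) - f' (ai + (t / Δi) • v)) (Δi⁻¹ • v)| := by
          rw [inner_sub_left]
      _ ≤ ‖f' (ai + (s / Δi) • v) - f' (ai + (t / Δi) • v)‖ * ‖Δi⁻¹ • v‖ :=
          abs_real_inner_le_norm _ _
      _ ≤ K * |s - t| := by
          rw [hunit, mul_one, ← hdist]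
          exact hlip _ (hmaps s hs) _ (hmaps t ht)
      _ ≤ m * |s - t| := mul_le_mul_of_nonneg_right hmK (abs_nonneg _)
  have hinner : ∀ x, inner ℝ (f' x) (Δi⁻¹ • v) = (∑ j, f' x j * (bi j - ai j)) / Δi := by
    intro x
    rw [real_inner_smul_right, PiLp.inner_apply, div_eq_inv_mul]
    simp [hv, mul_comm]
  have hp0 : p 0 = d0 := by simp only [p, zero_div, zero_smul, add_zero, hinner, hd0]
  have hpΔ : p Δi = dΔ := by
    have hend : ai + v = bi := add_sub_cancel ai bi
    simp only [p, div_self hΔ.ne', one_smul, hend, hinner, hdΔ]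
  have hg0 : g 0 = f ai := by simp [hg]
  have hgΔ : g Δi = f bi := by simp [hg, div_self hΔ.ne', hv]
  set X := g 0 - g Δi + dΔ * Δi + 0.5 * m * Δi ^ 2 with hX
  have hdiff : 2 * m * (y - y') = m * Δi + dΔ - d0 := by
    rw [hy, hy']
    field_simp
    ring
  have hsum : (m * Δi + dΔ - d0) * (y + y') = 2 * X := by
    rw [hy, hy']
    field_simp
    ring
  have hsq : m * (y ^ 2 - y' ^ 2) = X := by
    rw [← hdiff] at hsum
    linarith
  have hyy : y ≠ y' := by
    rintro rfl
    exact hne2 (by rw [← hdiff]; ring)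
  have hphi : phihat = (g 0 + m * y' ^ 2) - B ^ 2 / (2 * m) := by
    have hxB : B = -(m * xhat) := by
      rw [hB, hxhat]
      field_simp
      ring
    rw [hphihat, hxB]
    field_simp
    linarith
  intro t ht
  have htΔ : t * Δi ∈ Set.Icc (0 : ℝ) Δi :=
    ⟨mul_nonneg ht.1 hΔ.le, mul_le_of_le_one_left hΔ.le ht.2⟩
  have key := min_le_of_lipschitz_deriv (y := y) (y' := y') (B := B) (c := g 0 + m * y' ^ 2)
    hΔ hm hgp hpLip hyy (by rw [hp0]; linarith) (by rw [hpΔ]; linarith) (by ring)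
    (by rw [hpΔ]; linarith) htΔ
  rw [← hphi, hg0, hgΔ, ← hR, hg, mul_div_cancel_right₀ _ hΔ.ne'] at key
  exact key
end
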